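/- Let G be any subgroup of the group of piecewise linear homeomorphisms of [0,1]: each g ∈ G is an increasing homeomorphism of [0,1] for which there exist finitely many points 0 = t₀ < t₁ < ⋯ < tₙ = 1 such that g is affine on each interval [tᵢ, tᵢ₊₁]. Then every bounded 2-cocycle ω : G × G → ℝ is a bounded 2-coboundary, i.e. H²_b(G;ℝ) = 0. -/

import Mathlib

/-- `ω : G × G → ℝ` is a bounded 2-cocycle: it is bounded and satisfies the
2-cocycle identity `ω(g₂,g₃) − ω(g₁g₂,g₃) + ω(g₁,g₂g₃) − ω(g₁,g₂) = 0`. -/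
def IsBounded2Cocycle {G : Type*} [Group G] (ω : G → G → ℝ) : Prop :=
  (∃ C : ℝ, ∀ g h : G, |ω g h| ≤ C) ∧
    ∀ g₁ g₂ g₃ : G, ω g₂ g₃ - ω (g₁ * g₂) g₃ + ω g₁ (g₂ * g₃) - ω g₁ g₂ = 0

/-- `ω : G × G → ℝ` is a bounded 2-coboundary: there is a bounded `φ : G → ℝ`
with `ω(g₁,g₂) = φ(g₂) − φ(g₁g₂) + φ(g₁)`. -/
def IsBounded2Coboundary {G : Type*} [Group G] (ω : G → G → ℝ) : Prop :=
  ∃ φ : G → ℝ, (∃ C : ℝ, ∀ g : G, |φ g| ≤ C) ∧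
    ∀ g₁ g₂ : G, ω g₁ g₂ = φ g₂ - φ (g₁ * g₂) + φ g₁

/-- Vanishing of second bounded cohomology with trivial real coefficients:
every bounded 2-cocycle is a bounded 2-coboundary. -/
def HasVanishingH2b (G : Type*) [Group G] : Prop :=
  ∀ ω : G → G → ℝ, IsBounded2Cocycle ω → IsBounded2Coboundary ω

/-- `G` has commuting conjugates: for every finitely generated subgroup `H ≤ G`
there is `f ∈ G` with `[H, f⁻¹Hf] = 1` elementwise. -/
def HasCommutingConjugates (G : Type*) [Group G] : Prop :=
  ∀ H : Subgroup G, H.FG → ∃ f : G, ∀ h₁ ∈ H, ∀ h₂ ∈ H, Commute h₁ (f⁻¹ * h₂ * f)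

/-- `g : ℝ → ℝ` is piecewise affine on `[0,1]`: there are breakpoints
`0 = t₀ < t₁ < ⋯ < tₙ = 1` such that `g` is affine on each `[tᵢ, tᵢ₊₁]`. -/
def IsPLOnUnitInterval (g : ℝ → ℝ) : Prop :=
  ∃ (n : ℕ) (t : Fin (n + 1) → ℝ), StrictMono t ∧ t 0 = 0 ∧ t (Fin.last n) = 1 ∧
    ∀ i : Fin n, ∃ a b : ℝ, ∀ x ∈ Set.Icc (t i.castSucc) (t i.succ), g x = a * x + b

section

open Filter Topology Set
open scoped commutatorElement

/-- A homogeneous quasimorphism on a group. -/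
structure IsHomogeneousQuasimorphism {E : Type*} [Group E] (q : E → ℝ) : Prop where
  exists_defect : ∃ D : ℝ, ∀ x y : E, |q (x * y) - q x - q y| ≤ D
  map_pow : ∀ (x : E) (n : ℕ), q (x ^ n) = n * q x

lemma eq_zero_of_forall_abs_natCast_mul_le {a C : ℝ} (h : ∀ n : ℕ, |n * a| ≤ C) : a = 0 := by
  by_contra ha
  obtain ⟨n, hn⟩ := exists_nat_gt (C / |a|)
  have ha' : 0 < |a| := abs_pos.mpr ha
  rw [div_lt_iff₀ ha'] at hn
  have := h n
  rw [abs_mul, Nat.abs_cast] at this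
  linarith

/-- Every quasimorphism is at bounded distance from a homogeneous one. -/
theorem exists_isHomogeneousQuasimorphism_of_defect_le {E : Type*} [Group E] {r : E → ℝ} {C : ℝ}
    (hr : ∀ x y : E, |r (x * y) - r x - r y| ≤ C) :
    ∃ q : E → ℝ, IsHomogeneousQuasimorphism q ∧ ∀ x, |q x - r x| ≤ C := by
  have hC : 0 ≤ C := (abs_nonneg _).trans (hr 1 1)
  have near : ∀ x : E, ∀ n : ℕ, |r (x ^ (n + 1)) - (n + 1) * r x| ≤ n * C := by
    intro x n
    induction n with
    | zero => simp
    | succ n ih =>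
      have h := hr (x ^ (n + 1)) x
      rw [← pow_succ] at h
      rw [abs_le] at *
      push_cast
      constructor <;> linarith [h.1, h.2, ih.1, ih.2]
  have near_div : ∀ x : E, ∀ n : ℕ, n ≠ 0 → |r (x ^ n) / n - r x| ≤ C := by
    intro x n hn
    obtain ⟨n, rfl⟩ := Nat.exists_eq_succ_of_ne_zero hn
    have hpos : (0 : ℝ) < ((n + 1 : ℕ) : ℝ) := by positivity
    have h := near x n
    rw [Nat.succ_eq_add_one, div_sub' hpos.ne', abs_div, abs_of_pos hpos, div_le_iff₀ hpos]
    push_cast at *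
    linarith
  have sub : ∀ x : E, Subadditive fun n ↦ r (x ^ n) + C := by
    intro x m n
    have h := hr (x ^ m) (x ^ n)
    rw [← pow_add] at h
    have := (abs_le.mp h).2
    linarith
  have hconv : ∀ x : E, ∃ L, Tendsto (fun n : ℕ ↦ r (x ^ n) / n) atTop (𝓝 L) := by
    intro x
    have hbdd : BddBelow (range fun n : ℕ ↦ (r (x ^ n) + C) / n) := by
      refine ⟨-(|r x| + C), ?_⟩
      rintro _ ⟨n, rfl⟩
      rcases eq_or_ne n 0 with rfl | hn
      · simp only [Nat.cast_zero, div_zero]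
        linarith [abs_nonneg (r x)]
      · have h1 := (abs_le.mp (near_div x n hn)).1
        have h2 : 0 ≤ C / n := by positivity
        simp only [add_div]
        linarith [neg_abs_le (r x)]
    refine ⟨_, ((sub x).tendsto_lim hbdd).sub (tendsto_const_div_atTop_nhds_zero_nat C)
      |>.congr fun n ↦ ?_⟩
    ring
  choose q hq using hconv
  have hclose : ∀ x, |q x - r x| ≤ C := by
    intro x
    refine le_of_tendsto ((hq x).sub_const (r x)).abs ?_
    filter_upwards [eventually_ne_atTop 0] with n hn using near_div x n hn
  refine ⟨q, ⟨⟨C + 3 * C, fun x y ↦ ?_⟩, fun x k ↦ ?_⟩, hclose⟩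
  · have h0 := hr x y
    have h1 := hclose (x * y)
    have h2 := hclose x
    have h3 := hclose y
    rw [abs_le] at *
    constructor <;> linarith [h0.1, h0.2, h1.1, h1.2, h2.1, h2.2, h3.1, h3.2]
  · rcases Nat.eq_zero_or_pos k with rfl | hk
    · refine tendsto_nhds_unique (hq (x ^ 0)) ?_
      simpa using tendsto_const_div_atTop_nhds_zero_nat (r 1)
    · refine tendsto_nhds_unique (hq (x ^ k)) ?_
      have h := ((hq x).comp (tendsto_id.const_mul_atTop' hk)).const_mul (k : ℝ)
      refine h.congr fun n ↦ ?_
      have hk' : (k : ℝ) ≠ 0 := by positivity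
      rcases eq_or_ne n 0 with rfl | hn
      · simp
      · have hn' : (n : ℝ) ≠ 0 := by exact_mod_cast hn
        simp only [Function.comp, id, pow_mul, Nat.cast_mul]
        field_simp

namespace IsHomogeneousQuasimorphism

variable {E : Type*} [Group E] {q : E → ℝ}

lemma comp {F : Type*} [Group F] (hq : IsHomogeneousQuasimorphism q) (f : F →* E) :
    IsHomogeneousQuasimorphism (q ∘ f) := by
  obtain ⟨D, hD⟩ := hq.exists_defect
  exact ⟨⟨D, fun x y ↦ by simpa using hD (f x) (f y)⟩, fun x n ↦ by simp [hq.map_pow]⟩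

lemma map_one (hq : IsHomogeneousQuasimorphism q) : q 1 = 0 := by
  simpa using hq.map_pow 1 0

/-- If the powers of `x`, `y`, `z` satisfy `z ^ n = x ^ n * y ^ n` up to elements that `q` does
not see, then `q z = q x + q y`. -/
lemma eq_add_of_forall_pow (hq : IsHomogeneousQuasimorphism q) {x y z : E}
    (h : ∀ n : ℕ, q (z ^ n) = q (x ^ n * y ^ n)) : q z = q x + q y := by
  obtain ⟨D, hD⟩ := hq.exists_defect
  rw [← sub_eq_zero]
  refine eq_zero_of_forall_abs_natCast_mul_le (C := D) fun n ↦ ?_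
  have h1 := hD (x ^ n) (y ^ n)
  rw [← h, hq.map_pow, hq.map_pow, hq.map_pow] at h1
  convert h1 using 2
  ring

lemma map_mul_of_commute (hq : IsHomogeneousQuasimorphism q) {x y : E} (h : Commute x y) :
    q (x * y) = q x + q y :=
  hq.eq_add_of_forall_pow fun n ↦ by rw [h.mul_pow]

lemma map_inv (hq : IsHomogeneousQuasimorphism q) (x : E) : q x⁻¹ = -q x := by
  have := hq.map_mul_of_commute (Commute.refl x).inv_right
  rw [mul_inv_cancel, hq.map_one] at this
  linarith

lemma map_conj (hq : IsHomogeneousQuasimorphism q) (g x : E) : q (g * x * g⁻¹) = q x := by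
  obtain ⟨D, hD⟩ := hq.exists_defect
  rw [← sub_eq_zero]
  refine eq_zero_of_forall_abs_natCast_mul_le (C := D + D) fun n ↦ ?_
  have h1 := hD (g * x ^ n) g⁻¹
  have h2 := hD g (x ^ n)
  rw [← conj_pow, hq.map_pow, hq.map_inv] at h1
  rw [hq.map_pow] at h2
  rw [abs_le] at *
  constructor <;> linarith [h1.1, h1.2, h2.1, h2.2]

/-- The elements whose multiplication does not change `q` form a normal subgroup. -/
def radical (_hq : IsHomogeneousQuasimorphism q) : Subgroup E where
  carrier := {m | ∀ x, q (x * m) = q x}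
  one_mem' := by simp
  mul_mem' := fun {a b} ha hb x ↦ by rw [← mul_assoc, hb, ha]
  inv_mem' := fun {a} ha x ↦ by rw [← ha (x * a⁻¹), inv_mul_cancel_right]

lemma mem_radical (hq : IsHomogeneousQuasimorphism q) {m : E} :
    m ∈ hq.radical ↔ ∀ x, q (x * m) = q x := Iff.rfl

instance radical_normal (hq : IsHomogeneousQuasimorphism q) : hq.radical.Normal where
  conj_mem m hm g x := by
    have h := hm (g⁻¹ * x * g)
    rw [← hq.map_conj g, ← hq.map_conj g (g⁻¹ * x * g)] at h
    convert h using 2 <;> group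

/-- The homogeneous quasimorphism induced on the quotient by the radical. -/
def quotientMap (hq : IsHomogeneousQuasimorphism q) : E ⧸ hq.radical → ℝ :=
  Quotient.lift q fun a b hab ↦ by
    have h := QuotientGroup.leftRel_apply.mp hab
    rw [← hq.mem_radical.mp h a, mul_inv_cancel_left]

lemma quotientMap_isHomogeneousQuasimorphism (hq : IsHomogeneousQuasimorphism q) :
    IsHomogeneousQuasimorphism hq.quotientMap := by
  obtain ⟨D, hD⟩ := hq.exists_defect
  refine ⟨⟨D, fun x y ↦ ?_⟩, fun x n ↦ ?_⟩
  · obtain ⟨x, rfl⟩ := QuotientGroup.mk_surjective x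
    obtain ⟨y, rfl⟩ := QuotientGroup.mk_surjective y
    exact hD x y
  · obtain ⟨x, rfl⟩ := QuotientGroup.mk_surjective x
    exact hq.map_pow x n

/-- If `q` is additive on a normal subgroup, then every commutator in it lies in the radical. -/
lemma commutator_mem_radical (hq : IsHomogeneousQuasimorphism q) {M : Subgroup E} [hM : M.Normal]
    (hadd : ∀ x ∈ M, ∀ y ∈ M, q (x * y) = q x + q y) {u v : E} (h : ⁅u, v⁆ ∈ M) :
    ⁅u, v⁆ ∈ hq.radical := by
  obtain ⟨D, hD⟩ := hq.exists_defect
  have hpow : ∀ n : ℕ, ⁅u ^ n, v⁆ ∈ M ∧ q ⁅u ^ n, v⁆ = n * q ⁅u, v⁆ := by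
    intro n
    induction n with
    | zero => simp [hq.map_one, M.one_mem]
    | succ n ih =>
      have e : ⁅u ^ (n + 1), v⁆ = u * ⁅u ^ n, v⁆ * u⁻¹ * ⁅u, v⁆ := by
        simp only [commutatorElement_def, pow_succ']
        group
      have hc := hM.conj_mem _ ih.1 u
      rw [e, hadd _ hc _ h, hq.map_conj, ih.2]
      exact ⟨M.mul_mem hc h, by push_cast; ring⟩
  have hzero : q ⁅u, v⁆ = 0 := by
    refine eq_zero_of_forall_abs_natCast_mul_le (C := D) fun n ↦ ?_
    have h1 := hD (u ^ n * v * (u ^ n)⁻¹) v⁻¹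
    rw [hq.map_conj, hq.map_inv, ← commutatorElement_def, (hpow n).2] at h1
    convert h1 using 2
    ring
  generalize ⁅u, v⁆ = m at *
  intro x
  have hxm : ∀ n : ℕ, ∃ m' ∈ M, q m' = 0 ∧ (x * m) ^ n = x ^ n * m' := by
    intro n
    induction n with
    | zero => exact ⟨1, M.one_mem, hq.map_one, by simp⟩
    | succ n ih =>
      obtain ⟨m', hm', hm0, e⟩ := ih
      have hc : x⁻¹ * m' * x ∈ M := by simpa using hM.conj_mem _ hm' x⁻¹
      refine ⟨x⁻¹ * m' * x * m, M.mul_mem hc h, ?_, ?_⟩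
      · have := hq.map_conj x⁻¹ m'
        rw [inv_inv] at this
        rw [hadd _ hc _ h, this, hm0, hzero, add_zero]
      · rw [pow_succ, e, pow_succ]
        group
  rw [← sub_eq_zero]
  refine eq_zero_of_forall_abs_natCast_mul_le (C := D) fun n ↦ ?_
  obtain ⟨m', -, hm0, e⟩ := hxm n
  have h1 := hD (x ^ n) m'
  rw [← e, hq.map_pow, hq.map_pow, hm0] at h1
  convert h1 using 2
  ring

lemma commute_mk_radical (hq : IsHomogeneousQuasimorphism q) {M : Subgroup E} [M.Normal]
    (hadd : ∀ x ∈ M, ∀ y ∈ M, q (x * y) = q x + q y) {u v : E} (h : ⁅u, v⁆ ∈ M) :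
    Commute (u : E ⧸ hq.radical) (v : E ⧸ hq.radical) := by
  rw [← commutatorElement_eq_one_iff_commute, ← QuotientGroup.mk'_apply, ← QuotientGroup.mk'_apply,
    ← map_commutatorElement, QuotientGroup.mk'_apply, QuotientGroup.eq_one_iff]
  exact hq.commutator_mem_radical hadd h

/-- A homogeneous quasimorphism that is additive on the commutator subgroup is a homomorphism. -/
theorem map_mul_of_additive_on_commutator (hq : IsHomogeneousQuasimorphism q)
    (hadd : ∀ x ∈ commutator E, ∀ y ∈ commutator E, q (x * y) = q x + q y) (x y : E) :
    q (x * y) = q x + q y :=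
  hq.quotientMap_isHomogeneousQuasimorphism.map_mul_of_commute
    (hq.commute_mk_radical hadd (Subgroup.commutator_mem_commutator (Subgroup.mem_top x)
      (Subgroup.mem_top y) : ⁅x, y⁆ ∈ commutator E))

/-- A homogeneous quasimorphism is additive on a pair that some `g` displaces from itself. -/
lemma map_mul_of_displaced (hq : IsHomogeneousQuasimorphism q) {x y : E} (c : E →* E)
    (hc : ∀ z, q (c z) = q z)
    (hcomm : ∀ u ∈ ({x, y} : Set E), ∀ v ∈ ({x, y} : Set E), ∀ n : ℕ,
      Commute u (c^[n + 1] v)) :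
    q (x * y) = q x + q y := by
  obtain ⟨D, hD⟩ := hq.exists_defect
  let P : E → ℕ → E := fun z n ↦ Nat.rec 1 (fun _ p ↦ z * c p) n
  have P_succ : ∀ z n, P z (n + 1) = z * c (P z n) := fun _ _ ↦ rfl
  have hP : ∀ u ∈ ({x, y} : Set E), ∀ v ∈ ({x, y} : Set E), ∀ n k : ℕ,
      Commute u (c^[k + 1] (P v n)) := by
    intro u hu v hv n
    induction n with
    | zero =>
      intro k
      rw [show P v 0 = 1 from rfl, iterate_map_one]
      exact Commute.one_right u
    | succ n ih =>
      intro k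
      rw [P_succ, iterate_map_mul, ← Function.iterate_succ_apply]
      exact (hcomm u hu v hv k).mul_right (ih (k + 1))
  have hPc : ∀ u ∈ ({x, y} : Set E), ∀ v ∈ ({x, y} : Set E), ∀ n, Commute u (c (P v n)) :=
    fun u hu v hv n ↦ hP u hu v hv n 0
  have hPmul : ∀ n, P (x * y) n = P x n * P y n := by
    intro n
    induction n with
    | zero => simp [P]
    | succ n ih =>
      simp only [P_succ, ih, map_mul]
      have := (hPc y (by simp) x (by simp) n).eq
      simp only [mul_assoc]
      rw [← mul_assoc y, this, mul_assoc]
  have hqP : ∀ z, (∀ n, Commute z (c (P z n))) → ∀ n : ℕ, q (P z n) = n * q z := by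
    intro z hz n
    induction n with
    | zero => simp [P, hq.map_one]
    | succ n ih =>
      rw [P_succ, hq.map_mul_of_commute (hz n), hc, ih]
      push_cast
      ring
  have hx := hqP x (hPc x (by simp) x (by simp))
  have hy := hqP y (hPc y (by simp) y (by simp))
  have hxy := hqP (x * y) fun n ↦ by
    rw [hPmul, map_mul]
    exact .mul_left
      (.mul_right (hPc x (by simp) x (by simp) n) (hPc x (by simp) y (by simp) n))
      (.mul_right (hPc y (by simp) x (by simp) n) (hPc y (by simp) y (by simp) n))
  rw [← sub_eq_zero]
  refine eq_zero_of_forall_abs_natCast_mul_le (C := D) fun n ↦ ?_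
  have h1 := hD (P x n) (P y n)
  rw [← hPmul, hx, hy, hxy] at h1
  convert h1 using 2
  ring

/-- A version of `map_mul_of_displaced` modulo a normal subgroup on which `q` is additive. -/
lemma map_mul_of_displaced_mod (hq : IsHomogeneousQuasimorphism q) {M : Subgroup E} [M.Normal]
    (hadd : ∀ x ∈ M, ∀ y ∈ M, q (x * y) = q x + q y) {x y : E} (g : E)
    (hcomm : ∀ u ∈ ({x, y} : Set E), ∀ v ∈ ({x, y} : Set E), ∀ n : ℕ,
      ⁅u, g ^ (n + 1) * v * (g ^ (n + 1))⁻¹⁆ ∈ M) :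
    q (x * y) = q x + q y := by
  have hq' := hq.quotientMap_isHomogeneousQuasimorphism
  refine hq'.map_mul_of_displaced (x := (x : E ⧸ hq.radical)) (y := (y : E ⧸ hq.radical))
    (MulAut.conj (g : E ⧸ hq.radical)).toMonoidHom
    (fun z ↦ by simpa using hq'.map_conj (g : E ⧸ hq.radical) z) ?_
  have hiter : ∀ (v : E) (n : ℕ), (MulAut.conj (g : E ⧸ hq.radical)).toMonoidHom^[n] v =
      ((g ^ n * v * (g ^ n)⁻¹ : E) : E ⧸ hq.radical) := by
    intro v n
    induction n with
    | zero => simp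
    | succ n ih =>
      rw [Function.iterate_succ_apply', ih, MulEquiv.coe_toMonoidHom, MulAut.conj_apply,
        ← QuotientGroup.mk_inv, ← QuotientGroup.mk_mul, ← QuotientGroup.mk_mul]
      congr 1
      rw [pow_succ']
      group
  rintro u hu v hv n
  have lift : ∀ w ∈ ({(x : E ⧸ hq.radical), (y : E ⧸ hq.radical)} : Set (E ⧸ hq.radical)),
      ∃ w' ∈ ({x, y} : Set E), (w' : E ⧸ hq.radical) = w := by
    rintro w (rfl | rfl)
    · exact ⟨x, by simp, rfl⟩
    · exact ⟨y, by simp, rfl⟩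
  obtain ⟨u, hu', rfl⟩ := lift u hu
  obtain ⟨v, hv', rfl⟩ := lift v hv
  rw [hiter]
  exact hq.commute_mk_radical hadd (hcomm u hu' v hv' n)

end IsHomogeneousQuasimorphism

/-- An increasing homeomorphism of the line, supported in `[0, 1]`, whose one-sided germs at
every point are affine. -/
structure IsPLHomeo (g : Equiv.Perm ℝ) : Prop where
  strictMono : StrictMono g
  apply_of_nonpos : ∀ x ≤ 0, g x = x
  apply_of_one_le : ∀ x, 1 ≤ x → g x = x
  affine_right : ∀ p, ∃ a b : ℝ, ∀ᶠ x in 𝓝[≥] p, g x = a * x + b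
  affine_left : ∀ p, ∃ a b : ℝ, ∀ᶠ x in 𝓝[≤] p, g x = a * x + b

namespace IsPLHomeo

lemma of_isPLOnUnitInterval {g : Equiv.Perm ℝ} (hg : StrictMono g)
    (hout : ∀ x : ℝ, x ≤ 0 ∨ 1 ≤ x → g x = x) (hPL : IsPLOnUnitInterval g) : IsPLHomeo g := by
  obtain ⟨n, t, -, h0, h1, haff⟩ := hPL
  refine ⟨hg, fun x hx ↦ hout x (.inl hx), fun x hx ↦ hout x (.inr hx), fun p ↦ ?_, fun p ↦ ?_⟩
  · rcases lt_or_ge p 0 with hp | hp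
    · refine ⟨1, 0, ?_⟩
      filter_upwards [nhdsWithin_le_nhds (Iio_mem_nhds hp)] with x hx
      rw [hout x (.inl (le_of_lt hx))]; ring
    rcases lt_or_ge p 1 with hp1 | hp1
    · obtain ⟨i, hi, hi'⟩ : ∃ i : Fin n, t i.castSucc ≤ p ∧ p < t i.succ := by
        by_contra! h
        have hall : ∀ i, t i ≤ p := fun i ↦ Fin.induction (h0.trans_le hp) h i
        linarith [hall (Fin.last n)]
      obtain ⟨a, b, hab⟩ := haff i
      refine ⟨a, b, ?_⟩
      filter_upwards [Icc_mem_nhdsGE hi'] with x hx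
      exact hab x ⟨hi.trans hx.1, hx.2⟩
    · refine ⟨1, 0, ?_⟩
      filter_upwards [self_mem_nhdsWithin] with x hx
      rw [hout x (.inr (hp1.trans hx))]; ring
  · rcases lt_or_ge 1 p with hp | hp
    · refine ⟨1, 0, ?_⟩
      filter_upwards [nhdsWithin_le_nhds (Ioi_mem_nhds hp)] with x hx
      rw [hout x (.inr (le_of_lt hx))]; ring
    rcases lt_or_ge 0 p with hp1 | hp1
    · obtain ⟨i, hi, hi'⟩ : ∃ i : Fin n, t i.castSucc < p ∧ p ≤ t i.succ := by
        by_contra! h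
        have hall : ∀ i, t i < p := fun i ↦ Fin.induction (h0.trans_lt hp1) h i
        linarith [hall (Fin.last n)]
      obtain ⟨a, b, hab⟩ := haff i
      refine ⟨a, b, ?_⟩
      filter_upwards [Icc_mem_nhdsLE hi] with x hx
      exact hab x ⟨hx.1, hx.2.trans hi'⟩
    · refine ⟨1, 0, ?_⟩
      filter_upwards [self_mem_nhdsWithin] with x hx
      rw [hout x (.inl (le_trans hx hp1))]; ring

variable {g h : Equiv.Perm ℝ}

protected lemma continuous (hg : IsPLHomeo g) : Continuous g :=
  hg.strictMono.monotone.continuous_of_surjective g.surjective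

lemma isClosed_fixed (hg : IsPLHomeo g) : IsClosed {x | g x = x} :=
  isClosed_eq hg.continuous continuous_id

lemma eventually_notMem_frontier_of_affine {s : Set ℝ} {p a b : ℝ}
    (hs : ∀ x ∈ s, x ≠ p ∧ s ∈ 𝓝 x) (hcl : IsClosed {x | g x = x})
    (h : ∀ᶠ x in 𝓝[s] p, g x = a * x + b) :
    ∀ᶠ x in 𝓝[s] p, x ∉ frontier {x | g x = x} := by
  by_cases hab : a = 1 ∧ b = 0
  · obtain ⟨rfl, rfl⟩ := hab
    filter_upwards [eventually_eventually_nhdsWithin.mpr h, self_mem_nhdsWithin] with x hx hxs hxF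
    rw [nhdsWithin_eq_nhds.mpr (hs x hxs).2] at hx
    refine hxF.2 (mem_interior_iff_mem_nhds.mpr ?_)
    filter_upwards [hx] with y hy
    rw [hy]; ring
  · have hne : ∀ᶠ x in 𝓝[s] p, x ≠ b / (1 - a) := by
      rcases eq_or_ne p (b / (1 - a)) with hp | hp
      · rw [← hp]
        filter_upwards [self_mem_nhdsWithin] with x hx using (hs x hx).1
      · exact nhdsWithin_le_nhds (eventually_ne_nhds hp)
    filter_upwards [h, hne] with x hx hxne hxF
    have hfix : g x = x := hcl.frontier_subset hxF
    rw [hx] at hfix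
    have ha : a ≠ 1 := by
      rintro rfl
      exact hab ⟨rfl, by linarith⟩
    refine hxne ?_
    rw [eq_div_iff (sub_ne_zero.mpr ha.symm)]
    linarith

lemma eventually_notMem_frontier_fixed (hg : IsPLHomeo g) (p : ℝ) :
    ∀ᶠ x in 𝓝[≠] p, x ∉ frontier {x | g x = x} := by
  obtain ⟨a, b, hab⟩ := hg.affine_left p
  obtain ⟨a', b', hab'⟩ := hg.affine_right p
  rw [← nhdsLT_sup_nhdsGT, eventually_sup]
  exact ⟨eventually_notMem_frontier_of_affine (fun x hx ↦ ⟨ne_of_lt hx, Iio_mem_nhds hx⟩)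
      hg.isClosed_fixed (hab.filter_mono (nhdsWithin_mono p Iio_subset_Iic_self)),
    eventually_notMem_frontier_of_affine (fun x hx ↦ ⟨ne_of_gt hx, Ioi_mem_nhds hx⟩)
      hg.isClosed_fixed (hab'.filter_mono (nhdsWithin_mono p Ioi_subset_Ici_self))⟩

lemma finite_frontier_fixed_inter (hg : IsPLHomeo g) :
    (frontier {x | g x = x} ∩ Icc 0 1).Finite := by
  by_contra hinf
  obtain ⟨p, -, hp⟩ := Set.Infinite.exists_accPt_of_subset_isCompact hinf isCompact_Icc
    inter_subset_right
  rw [accPt_iff_frequently_nhdsNE] at hp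
  exact hp ((hg.eventually_notMem_frontier_fixed p).mono fun x hx hx' ↦ hx hx'.1)

lemma eventually_mul_comm_of_affine {s : Set ℝ} {p a b a' b' : ℝ} (hps : p ∈ s)
    (hgs : ∀ᶠ x in 𝓝[s] p, g x = a * x + b) (hhs : ∀ᶠ x in 𝓝[s] p, h x = a' * x + b')
    (hg : Tendsto g (𝓝[s] p) (𝓝[s] p)) (hh : Tendsto h (𝓝[s] p) (𝓝[s] p))
    (hgp : g p = p) (hhp : h p = p) : ∀ᶠ x in 𝓝[s] p, g (h x) = h (g x) := by
  have h1 := hgs.self_of_nhdsWithin hps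
  have h2 := hhs.self_of_nhdsWithin hps
  filter_upwards [hgs, hhs, hh.eventually hgs, hg.eventually hhs] with x e1 e2 e3 e4
  rw [e3, e4, e1, e2]
  rw [hgp] at h1
  rw [hhp] at h2
  obtain rfl : b = p - a * p := by linarith
  obtain rfl : b' = p - a' * p := by linarith
  ring

/-- Two piecewise linear homeomorphisms commute near a common fixed point. -/
lemma eventually_mul_comm (hg : IsPLHomeo g) (hh : IsPLHomeo h) {p : ℝ} (hgp : g p = p)
    (hhp : h p = p) : ∀ᶠ x in 𝓝 p, g (h x) = h (g x) := by
  have tend : ∀ {f : Equiv.Perm ℝ}, IsPLHomeo f → f p = p → ∀ {s : Set ℝ}, MapsTo f s s →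
      Tendsto f (𝓝[s] p) (𝓝[s] p) := by
    intro f hf hfp s hs
    have := hf.continuous.continuousWithinAt.tendsto_nhdsWithin (x := p) hs
    rwa [hfp] at this
  have right : ∀ {f : Equiv.Perm ℝ}, IsPLHomeo f → f p = p → MapsTo f (Ici p) (Ici p) :=
    fun hf hfp x hx ↦ hfp.symm.trans_le (hf.strictMono.monotone hx)
  have left : ∀ {f : Equiv.Perm ℝ}, IsPLHomeo f → f p = p → MapsTo f (Iic p) (Iic p) :=
    fun hf hfp x hx ↦ (hf.strictMono.monotone hx).trans_eq hfp
  rw [← nhdsLE_sup_nhdsGE, eventually_sup]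
  obtain ⟨a, b, hab⟩ := hg.affine_left p
  obtain ⟨a', b', hab'⟩ := hh.affine_left p
  obtain ⟨c, d, hcd⟩ := hg.affine_right p
  obtain ⟨c', d', hcd'⟩ := hh.affine_right p
  exact ⟨eventually_mul_comm_of_affine self_mem_Iic hab hab' (tend hg hgp (left hg hgp))
      (tend hh hhp (left hh hhp)) hgp hhp,
    eventually_mul_comm_of_affine self_mem_Ici hcd hcd' (tend hg hgp (right hg hgp))
      (tend hh hhp (right hh hhp)) hgp hhp⟩

end IsPLHomeo

lemma subset_or_disjoint_of_disjoint_frontier {I s : Set ℝ} (hI : IsPreconnected I)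
    (hs : IsClosed s) (hd : Disjoint I (frontier s)) : I ⊆ s ∨ Disjoint I s := by
  by_contra! hcon
  obtain ⟨h1, h2⟩ := hcon
  obtain ⟨x, hxI, hxs⟩ := not_subset.mp h1
  obtain ⟨y, hyI, hys⟩ := not_disjoint_iff.mp h2
  have hint : ∀ z ∈ I, z ∈ s → z ∈ interior s := by
    intro z hzI hzs
    by_contra hz
    exact disjoint_left.mp hd hzI ⟨subset_closure hzs, hz⟩
  obtain ⟨z, -, hz, hz'⟩ := hI (interior s) sᶜ isOpen_interior hs.isOpen_compl
    (fun z hz ↦ (em (z ∈ s)).imp (hint z hz) id) ⟨y, hyI, hint y hyI hys⟩ ⟨x, hxI, hxs⟩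
  exact hz' (interior_subset hz)

/-- The subgroup of permutations that are the identity near `p`. -/
def trivialGermSubgroup (p : ℝ) : Subgroup (Equiv.Perm ℝ) where
  carrier := {g | ∀ᶠ x in 𝓝 p, g x = x}
  one_mem' := by simp
  mul_mem' := fun {a b} ha hb ↦ by
    filter_upwards [ha, hb] with x hxa hxb
    rw [Equiv.Perm.mul_apply, hxb, hxa]
  inv_mem' := fun {a} ha ↦ by
    filter_upwards [ha] with x hx
    rw [Equiv.Perm.inv_eq_iff_eq, hx]

section Action

variable {E : Type*} [Group E] {π : E →* Equiv.Perm ℝ}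

lemma commutator_le_comap_trivialGermSubgroup (hπ : ∀ e, IsPLHomeo (π e)) {p : ℝ}
    (hp : ∀ e, π e p = p) : commutator E ≤ (trivialGermSubgroup p).comap π := by
  rw [commutator_def, Subgroup.commutator_le]
  intro u _ v _
  have hcont : Tendsto (π (u⁻¹ * v⁻¹)) (𝓝 p) (𝓝 p) := by
    have := (hπ (u⁻¹ * v⁻¹)).continuous.tendsto p
    rwa [hp] at this
  have := hcont.eventually ((hπ u).eventually_mul_comm (hπ v) (hp u) (hp v))
  change ∀ᶠ x in 𝓝 p, π ⁅u, v⁆ x = x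
  filter_upwards [this] with x hx
  have e : π ⁅u, v⁆ x = π u (π v (π (u⁻¹ * v⁻¹) x)) := by
    simp only [commutatorElement_def, map_mul, Equiv.Perm.mul_apply]
  rw [e, hx]
  simp

/-- If there is no global fixed point in `(p', p)`, then every point of it can be moved
arbitrarily close to `p`. -/
lemma exists_lt_apply (hπ : ∀ e, StrictMono (π e)) {p' p c d : ℝ}
    (hfix : ∀ s ∈ Ioo p' p, ∃ e, π e s ≠ s) (hc : p' < c) (hd : d < p) :
    ∃ e, d < π e c := by
  by_contra! hcon
  have hbdd : BddAbove (range fun e ↦ π e c) := ⟨d, by rintro _ ⟨e, rfl⟩; exact hcon e⟩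
  set s := sSup (range fun e ↦ π e c) with hs
  have hle : ∀ e, π e c ≤ s := fun e ↦ le_csSup hbdd ⟨e, rfl⟩
  have hsd : s ≤ d := csSup_le (range_nonempty _) (by rintro _ ⟨e, rfl⟩; exact hcon e)
  have hcs : c ≤ s := by simpa using hle 1
  have hinc : ∀ e, s ≤ π e s := by
    intro e
    refine csSup_le (range_nonempty _) ?_
    rintro _ ⟨e', rfl⟩
    have := (hπ e).monotone (hle (e⁻¹ * e'))
    simpa using this
  obtain ⟨e, he⟩ := hfix s ⟨hc.trans_le hcs, hsd.trans_lt hd⟩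
  refine he (le_antisymm ?_ (hinc e))
  have := (hπ e).monotone (hinc e⁻¹)
  simpa using this

lemma commute_apply_of_disjoint {A B : Equiv.Perm ℝ} {J : Set ℝ} (hA : MapsTo A J J)
    (hB : MapsTo B J J) (hAB : ∀ s ∈ J, A s = s ∨ B s = s) {s : ℝ} (hs : s ∈ J) :
    A (B s) = B (A s) := by
  by_cases h1 : A s = s <;> by_cases h2 : B s = s
  · rw [h1, h2, h1]
  · rw [h1]
    exact (hAB _ (hB hs)).resolve_right fun h ↦ h2 (B.injective h)
  · rw [h2]
    exact ((hAB _ (hA hs)).resolve_left fun h ↦ h1 (A.injective h)).symm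
  · exact ((hAB s hs).elim h1 h2).elim

/-- The commutators that act trivially on `(-∞, t]`. -/
def commutatorFixing (π : E →* Equiv.Perm ℝ) (t : ℝ) : Subgroup E where
  carrier := {x | x ∈ commutator E ∧ ∀ s ≤ t, π x s = s}
  one_mem' := ⟨one_mem _, by simp⟩
  mul_mem' := fun {a b} ha hb ↦ ⟨mul_mem ha.1 hb.1, fun s hs ↦ by
    rw [map_mul, Equiv.Perm.mul_apply, hb.2 s hs, ha.2 s hs]⟩
  inv_mem' := fun {a} ha ↦ ⟨inv_mem ha.1, fun s hs ↦ by
    rw [map_inv, Equiv.Perm.inv_eq_iff_eq, ha.2 s hs]⟩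

lemma commutatorFixing_normal (hπ : ∀ e, StrictMono (π e)) {t : ℝ} (ht : ∀ e, π e t = t) :
    (commutatorFixing π t).Normal where
  conj_mem x hx g := by
    refine ⟨Subgroup.Normal.conj_mem inferInstance x hx.1 g, fun s hs ↦ ?_⟩
    have h1 : π g⁻¹ s ≤ t := ((hπ g⁻¹).monotone hs).trans_eq (ht _)
    rw [map_mul, map_mul, Equiv.Perm.mul_apply, Equiv.Perm.mul_apply, hx.2 _ h1]
    simp

lemma exists_displacing (hπ : ∀ e, IsPLHomeo (π e)) {p' p : ℝ} (hlt : p' < p)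
    (hp' : ∀ e, π e p' = p') (hp : ∀ e, π e p = p) (hfix : ∀ s ∈ Ioo p' p, ∃ e, π e s ≠ s)
    {x y : E} (hx : x ∈ commutatorFixing π p') (hy : y ∈ commutatorFixing π p') :
    ∃ g : E, ∀ u ∈ ({x, y} : Set E), ∀ v ∈ ({x, y} : Set E), ∀ n : ℕ,
      ⁅u, g ^ (n + 1) * v * (g ^ (n + 1))⁻¹⁆ ∈ commutatorFixing π p := by
  have hmem : ∀ u ∈ ({x, y} : Set E), u ∈ commutatorFixing π p' := by
    rintro u (rfl | rfl) <;> assumption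
  have germ : ∀ r, (∀ e, π e r = r) → ∀ᶠ s in 𝓝 r, ∀ u ∈ ({x, y} : Set E), π u s = s := by
    intro r hr
    have h := commutator_le_comap_trivialGermSubgroup hπ hr
    have h1 : ∀ᶠ s in 𝓝 r, π x s = s := h hx.1
    have h2 : ∀ᶠ s in 𝓝 r, π y s = s := h hy.1
    filter_upwards [h1, h2] with s h1 h2
    rintro u (rfl | rfl) <;> assumption
  obtain ⟨ε, hε, hεs⟩ := Metric.eventually_nhds_iff.mp (germ p' hp')
  obtain ⟨δ, hδ, hδs⟩ := Metric.eventually_nhds_iff.mp (germ p hp)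
  obtain ⟨c, hc, hcmid, hcε⟩ : ∃ c, p' < c ∧ c ≤ (p' + p) / 2 ∧ c < p' + ε :=
    ⟨min (p' + ε / 2) ((p' + p) / 2), by rw [lt_min_iff]; constructor <;> linarith,
      min_le_right _ _, by rw [min_lt_iff]; left; linarith⟩
  obtain ⟨d, hd, hdmid, hdδ⟩ : ∃ d, d < p ∧ (p' + p) / 2 ≤ d ∧ p - δ < d :=
    ⟨max (p - δ / 2) ((p' + p) / 2), by rw [max_lt_iff]; constructor <;> linarith,
      le_max_right _ _, by rw [lt_max_iff]; left; linarith⟩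
  have below : ∀ u ∈ ({x, y} : Set E), ∀ s ≤ c, π u s = s := by
    intro u hu s hs
    rcases le_or_gt s p' with h | h
    · exact (hmem u hu).2 s h
    · refine hεs ?_ u hu
      rw [Real.dist_eq, abs_lt]
      constructor <;> linarith
  have above : ∀ u ∈ ({x, y} : Set E), ∀ s, d ≤ s → s ≤ p → π u s = s := by
    intro u hu s hs hsp
    refine hδs ?_ u hu
    rw [Real.dist_eq, abs_lt]
    constructor <;> linarith
  obtain ⟨g, hg⟩ := exists_lt_apply (fun e ↦ (hπ e).strictMono) hfix hc hd
  refine ⟨g, fun u hu v hv n ↦ ?_⟩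
  have hgn : d < π (g ^ (n + 1)) c := by
    induction n with
    | zero => simpa using hg
    | succ n ih =>
      rw [pow_succ', map_mul, Equiv.Perm.mul_apply]
      exact hg.trans ((hπ g).strictMono ((hcmid.trans hdmid).trans_lt ih))
  generalize g ^ (n + 1) = k at hgn
  set w := k * v * k⁻¹ with hw
  refine ⟨Subgroup.commutator_mem_commutator (Subgroup.mem_top u) (Subgroup.mem_top w),
    fun s hs ↦ ?_⟩
  have maps : ∀ e, MapsTo (π e) (Iic p) (Iic p) :=
    fun e s hs ↦ ((hπ e).strictMono.monotone hs).trans_eq (hp e)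
  have hdisj : ∀ s ∈ Iic p, π u s = s ∨ π w s = s := by
    intro s hs
    rcases le_or_gt s c with h | h
    · exact .inl (below u hu s h)
    rcases le_or_gt d s with h' | h'
    · exact .inl (above u hu s h' hs)
    right
    have h1 : π k⁻¹ s ≤ c := by
      have := (hπ k⁻¹).strictMono.monotone (h'.trans hgn).le
      simpa using this
    rw [hw, map_mul, map_mul, Equiv.Perm.mul_apply, Equiv.Perm.mul_apply, below v hv _ h1]
    simp
  have hs' : π (u⁻¹ * w⁻¹) s ∈ Iic p := maps _ hs
  have e : π ⁅u, w⁆ s = π u (π w (π (u⁻¹ * w⁻¹) s)) := by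
    simp only [commutatorElement_def, map_mul, Equiv.Perm.mul_apply]
  rw [e, commute_apply_of_disjoint (maps u) (maps w) hdisj hs']
  simp

/-- Additivity for groups whose set of global fixed points is that of two elements. -/
theorem IsHomogeneousQuasimorphism.map_mul_of_fixed_pair {q : E → ℝ}
    (hq : IsHomogeneousQuasimorphism q) (hπ : ∀ e, IsPLHomeo (π e))
    (hker : ∀ x ∈ π.ker, ∀ y ∈ π.ker, q (x * y) = q x + q y) {a b : E}
    (hab : ∀ s, π a s = s → π b s = s → ∀ e, π e s = s) (x y : E) :
    q (x * y) = q x + q y := by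
  set K : Set ℝ := {s | π a s = s} ∩ {s | π b s = s} with hK
  have hKfix : ∀ s ∈ K, ∀ e, π e s = s := fun s hs ↦ hab s hs.1 hs.2
  have hKcl : IsClosed K := (hπ a).isClosed_fixed.inter (hπ b).isClosed_fixed
  have hfin : (frontier K ∩ Icc 0 1).Finite := by
    refine ((hπ a).finite_frontier_fixed_inter.union (hπ b).finite_frontier_fixed_inter).subset ?_
    rintro s ⟨hs, hsI⟩
    rcases frontier_inter_subset _ _ hs with h | h
    · exact .inl ⟨h.1, hsI⟩
    · exact .inr ⟨h.2, hsI⟩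
  set P : Set ℝ := (frontier K ∩ Icc 0 1) ∪ {0, 1} with hP
  have hPfin : P.Finite := hfin.union (by simp)
  have hPI : P ⊆ Icc 0 1 := by
    rintro s (hs | rfl | rfl)
    · exact hs.2
    · simp
    · simp
  have hPfix : ∀ s ∈ P, ∀ e, π e s = s := by
    rintro s (hs | rfl | rfl) e
    · exact hKfix s (hKcl.frontier_subset hs.1) e
    · exact (hπ e).apply_of_nonpos _ le_rfl
    · exact (hπ e).apply_of_one_le _ le_rfl
  let Q : ℝ → Prop := fun t ↦
    ∀ x ∈ commutatorFixing π t, ∀ y ∈ commutatorFixing π t, q (x * y) = q x + q y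
  have hQ1 : Q 1 := by
    have : commutatorFixing π 1 ≤ π.ker := fun x hx ↦ by
      rw [MonoidHom.mem_ker]
      ext s
      rcases le_total s 1 with h | h
      · exact hx.2 s h
      · exact (hπ x).apply_of_one_le s h
    exact fun x hx y hy ↦ hker x (this hx) y (this hy)
  have step : ∀ p ∈ P, Q p → p ≠ 0 → ∃ p' ∈ P, p' < p ∧ Q p' := by
    intro p hpP hQp hp0
    have hp_pos : 0 < p := lt_of_le_of_ne (hPI hpP).1 hp0.symm
    obtain ⟨p', ⟨hp'P, hlt⟩, hmax⟩ := (hPfin.subset (sep_subset P (· < p))).exists_maximal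
      ⟨0, by simp [hP], hp_pos⟩
    refine ⟨p', hp'P, hlt, fun x hx y hy ↦ ?_⟩
    have hdisj : Disjoint (Ioo p' p) (frontier K) := by
      rw [disjoint_left]
      intro s hs hsF
      have hsP : s ∈ P := .inl ⟨hsF, (hPI hp'P).1.trans hs.1.le, hs.2.le.trans (hPI hpP).2⟩
      exact absurd (hmax ⟨hsP, hs.2⟩ hs.1.le) (not_le.mpr hs.1)
    rcases subset_or_disjoint_of_disjoint_frontier isPreconnected_Ioo hKcl hdisj with h | h
    · have hle : commutatorFixing π p' ≤ commutatorFixing π p := by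
        refine fun x hx ↦ ⟨hx.1, fun s hs ↦ ?_⟩
        rcases le_or_gt s p' with h1 | h1
        · exact hx.2 s h1
        · rcases hs.eq_or_lt with rfl | h2
          · exact hPfix s hpP x
          · exact hKfix s (h ⟨h1, h2⟩) x
      exact hQp x (hle hx) y (hle hy)
    · have hfix : ∀ s ∈ Ioo p' p, ∃ e, π e s ≠ s := by
        intro s hs
        by_contra! hcon
        exact disjoint_left.mp h hs ⟨hcon a, hcon b⟩
      obtain ⟨g, hg⟩ := exists_displacing hπ hlt (hPfix p' hp'P) (hPfix p hpP) hfix hx hy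
      have := commutatorFixing_normal (fun e ↦ (hπ e).strictMono) (hPfix p hpP)
      exact hq.map_mul_of_displaced_mod hQp g hg
  have hQ0 : Q 0 := by
    obtain ⟨p, ⟨hpP, hQp⟩, hmin⟩ := (hPfin.subset (sep_subset P Q)).exists_minimal
      ⟨1, by simp [hP], hQ1⟩
    rcases eq_or_ne p 0 with rfl | hp0
    · exact hQp
    · obtain ⟨p', hp'P, hlt, hQp'⟩ := step p hpP hQp hp0
      exact absurd (hmin ⟨hp'P, hQp'⟩ hlt.le) (not_le.mpr hlt)
  have hmem : ∀ x ∈ commutator E, x ∈ commutatorFixing π 0 :=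
    fun x hx ↦ ⟨hx, (hπ x).apply_of_nonpos⟩
  exact hq.map_mul_of_additive_on_commutator
    (fun x hx y hy ↦ hQ0 x (hmem x hx) y (hmem y hy)) x y

/-- A homogeneous quasimorphism on a group acting by piecewise linear homeomorphisms is a
homomorphism as soon as it is additive on the kernel of the action. -/
theorem IsHomogeneousQuasimorphism.map_mul_of_isPLHomeo {q : E → ℝ}
    (hq : IsHomogeneousQuasimorphism q) (hπ : ∀ e, IsPLHomeo (π e))
    (hker : ∀ x ∈ π.ker, ∀ y ∈ π.ker, q (x * y) = q x + q y) (x y : E) :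
    q (x * y) = q x + q y := by
  let f : FreeGroup Bool →* E := FreeGroup.lift fun i ↦ cond i x y
  have key := (hq.comp f).map_mul_of_fixed_pair (π := π.comp f) (fun e ↦ hπ (f e))
    (fun u hu v hv ↦ by
      simp only [Function.comp_apply, map_mul]
      exact hker _ hu _ hv)
    (a := FreeGroup.of true) (b := FreeGroup.of false) ?_
    (FreeGroup.of true) (FreeGroup.of false)
  · simpa [f] using key
  intro s ha hb e
  induction e using FreeGroup.induction_on with
  | C1 => simp
  | of i => cases i <;> assumption
  | inv_of i h => rw [_root_.map_inv, Equiv.Perm.inv_eq_iff_eq, h]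
  | mul u v hu hv => rw [map_mul, Equiv.Perm.mul_apply, hv, hu]

end Action

/-- The central extension by `ℝ` defined by a 2-cocycle. -/
@[ext]
structure CocycleExtension {G : Type*} [Group G] (ω : G → G → ℝ) where
  /-- The real coordinate. -/
  fst : ℝ
  /-- The projection to the base group. -/
  snd : G

namespace CocycleExtension

variable {G : Type*} [Group G] {ω : G → G → ℝ}

instance : Mul (CocycleExtension ω) := ⟨fun x y ↦ ⟨x.fst + y.fst + ω x.snd y.snd, x.snd * y.snd⟩⟩

lemma mul_def (x y : CocycleExtension ω) :
    x * y = ⟨x.fst + y.fst + ω x.snd y.snd, x.snd * y.snd⟩ := rfl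

lemma cocycle_one_left (hω : IsBounded2Cocycle ω) (g : G) : ω 1 g = ω 1 1 := by
  have := hω.2 1 1 g
  simp only [one_mul] at this
  linarith

/-- The group structure of the extension. -/
@[reducible]
def group (hω : IsBounded2Cocycle ω) : Group (CocycleExtension ω) :=
  letI : One (CocycleExtension ω) := ⟨⟨-ω 1 1, 1⟩⟩
  letI : Inv (CocycleExtension ω) := ⟨fun x ↦ ⟨-x.fst - ω x.snd⁻¹ x.snd - ω 1 1, x.snd⁻¹⟩⟩
  Group.ofLeftAxioms
    (fun x y z ↦ by
      have := hω.2 x.snd y.snd z.snd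
      simp only [mul_def, mul_assoc, mk.injEq, and_true]
      linarith)
    (fun x ↦ by
      change (⟨-ω 1 1 + x.fst + ω 1 x.snd, 1 * x.snd⟩ : CocycleExtension ω) = x
      ext
      · simp [cocycle_one_left hω x.snd]
      · simp)
    (fun x ↦ by
      change (⟨(-x.fst - ω x.snd⁻¹ x.snd - ω 1 1) + x.fst + ω x.snd⁻¹ x.snd, x.snd⁻¹ * x.snd⟩ :
        CocycleExtension ω) = ⟨-ω 1 1, 1⟩
      ext
      · ring
      · simp)

end CocycleExtension

/-- A bounded 2-cocycle is a bounded coboundary as soon as every homogeneous quasimorphism on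
every central extension of the group, additive on the kernel, is a homomorphism. -/
theorem IsBounded2Cocycle.isBounded2Coboundary.{u} {G : Type u} [Group G] {ω : G → G → ℝ}
    (hω : IsBounded2Cocycle ω)
    (H : ∀ (E : Type u) [Group E] (p : E →* G) (q : E → ℝ), IsHomogeneousQuasimorphism q →
      (∀ x ∈ p.ker, ∀ y ∈ p.ker, q (x * y) = q x + q y) → ∀ x y, q (x * y) = q x + q y) :
    IsBounded2Coboundary ω := by
  let := CocycleExtension.group hω
  obtain ⟨C, hC⟩ := hω.1
  obtain ⟨q, hq, hqC⟩ := exists_isHomogeneousQuasimorphism_of_defect_le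
    (r := (CocycleExtension.fst : CocycleExtension ω → ℝ)) (C := C) fun x y ↦ by
      rw [CocycleExtension.mul_def]
      convert hC x.snd y.snd using 2
      ring
  let p : CocycleExtension ω →* G := MonoidHom.mk' CocycleExtension.snd fun _ _ ↦ rfl
  have hadd := H (CocycleExtension ω) p q hq fun x hx y hy ↦ by
    have hx1 : x.snd = 1 := hx
    have hy1 : y.snd = 1 := hy
    refine hq.map_mul_of_commute ?_
    change x * y = y * x
    rw [CocycleExtension.mul_def, CocycleExtension.mul_def, hx1, hy1, add_comm x.fst]
  let z : ℝ → CocycleExtension ω := fun s ↦ ⟨s - ω 1 1, 1⟩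
  have hz_pow : ∀ (s : ℝ) (n : ℕ), q (z (n * s)) = n * q (z s) := by
    intro s n
    rw [← hq.map_pow]
    congr 1
    induction n with
    | zero =>
      change (⟨((0 : ℕ) : ℝ) * s - ω 1 1, 1⟩ : CocycleExtension ω) = ⟨-ω 1 1, 1⟩
      simp
    | succ n ih =>
      rw [pow_succ, ← ih, CocycleExtension.mul_def]
      ext
      · simp only [z]
        push_cast
        ring
      · simp [z]
  have hz : ∀ s, q (z s) = s := by
    intro s
    rw [← sub_eq_zero]
    refine eq_zero_of_forall_abs_natCast_mul_le (C := C + |ω 1 1|) fun n ↦ ?_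
    have h1 := hqC (z (n * s))
    rw [hz_pow] at h1
    have e : n * (q (z s) - s) = (n * q (z s) - (z (n * s)).fst) + -ω 1 1 := by
      simp only [z]
      ring
    rw [e]
    exact (abs_add_le _ _).trans (by rw [abs_neg]; linarith)
  have hsplit : ∀ s g, q ⟨s, g⟩ = s + q ⟨0, g⟩ := by
    intro s g
    rw [← congrArg (· + q ⟨0, g⟩) (hz s), ← hadd, CocycleExtension.mul_def]
    simp [z, CocycleExtension.cocycle_one_left hω g]
  refine ⟨fun g ↦ q ⟨0, g⟩, ⟨C, fun g ↦ by simpa using hqC ⟨0, g⟩⟩, fun g h ↦ ?_⟩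
  have h1 := hadd ⟨0, g⟩ ⟨0, h⟩
  rw [CocycleExtension.mul_def, hsplit] at h1
  simp only [zero_add] at h1
  linarith

end

/-- Any group of piecewise linear homeomorphisms of `[0,1]`
(modelled as increasing bijections of `ℝ` that agree with the identity outside
`[0,1]` and are piecewise affine on `[0,1]`) has vanishing second bounded
cohomology: every bounded 2-cocycle is a bounded 2-coboundary. -/
theorem PL_unitInterval_vanishing_H2b
    (G : Subgroup (Equiv.Perm ℝ))
    (hG : ∀ g ∈ G, StrictMono ⇑g ∧ (∀ x : ℝ, x ≤ 0 ∨ 1 ≤ x → g x = x) ∧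
      IsPLOnUnitInterval ⇑g)
    (ω : G → G → ℝ) (hω : IsBounded2Cocycle ω) :
    IsBounded2Coboundary ω := by
  exact hω.isBounded2Coboundary fun _ _ p q hq hker ↦
    hq.map_mul_of_isPLHomeo (π := G.subtype.comp p)
      (fun e ↦ let h := hG _ (p e).2; .of_isPLOnUnitInterval h.1 h.2.1 h.2.2)
      (fun x hx y hy ↦ hker x (Subtype.ext hx) y (Subtype.ext hy))
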